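/- For every h ∈ (−1,0) the following hold: I_{−5}(h) = (1+h)π/4; I_{−3}(h) = (1 − √(−h))π/2; and I_{−1}(h) = ((−h)^{−1/2} − 1)π/2. -/

import Mathlib

open intervalIntegral Real

section RadicandAntiderivatives

variable {m s a b x : ℝ}

/-- The radicand `-1 + 2x² - m²x⁴` after completing the square. -/
lemma radicand_eq (hsm : s ^ 2 = 1 - m ^ 2) :
    m ^ 2 * (-1 + 2 * x ^ 2 + -m ^ 2 * x ^ 4) = s ^ 2 - (m ^ 2 * x ^ 2 - 1) ^ 2 := by
  rw [hsm]; ring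

lemma radicand_pos (hm : 0 < m) (hs : 0 < s) (hsm : s ^ 2 = 1 - m ^ 2) (ha : 0 < a)
    (ha2 : m ^ 2 * a ^ 2 = 1 - s) (hb2 : m ^ 2 * b ^ 2 = 1 + s) (hx : x ∈ Set.Ioo a b) :
    0 < -1 + 2 * x ^ 2 + -m ^ 2 * x ^ 4 := by
  have hm2 : 0 < m ^ 2 := by positivity
  have hax : m ^ 2 * a ^ 2 < m ^ 2 * x ^ 2 := by
    have := hx.1
    gcongr
  have hxb : m ^ 2 * x ^ 2 < m ^ 2 * b ^ 2 := by
    have := hx.2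
    have := ha.trans hx.1
    gcongr
  refine pos_of_mul_pos_right (a := m ^ 2) ?_ hm2.le
  rw [radicand_eq hsm]
  nlinarith

lemma hasDerivAt_sqrt_radicand (hQ : 0 < -1 + 2 * x ^ 2 + -m ^ 2 * x ^ 4) :
    HasDerivAt (fun x : ℝ => √(-1 + 2 * x ^ 2 + -m ^ 2 * x ^ 4))
      ((2 * x - 2 * m ^ 2 * x ^ 3) / √(-1 + 2 * x ^ 2 + -m ^ 2 * x ^ 4)) x := by
  have h : HasDerivAt (fun x : ℝ => -1 + 2 * x ^ 2 + -m ^ 2 * x ^ 4)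
      (4 * x - 4 * m ^ 2 * x ^ 3) x := by
    refine HasDerivAt.congr_deriv ((((hasDerivAt_pow 2 x).const_mul 2).const_add (-1)).add
      ((hasDerivAt_pow 4 x).const_mul (-m ^ 2))) ?_
    norm_num
    ring
  refine HasDerivAt.congr_deriv (h.sqrt hQ.ne') ?_
  have := Real.sqrt_pos.2 hQ
  field_simp
  ring

lemma hasDerivAt_arcsin_of_sq {f : ℝ → ℝ} {f' r : ℝ} (hf : HasDerivAt f f' x) (hr : 0 < r)
    (hfr : 1 - f x ^ 2 = r ^ 2) : HasDerivAt (fun x => arcsin (f x)) (f' / r) x := by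
  have hr2 : 0 < r ^ 2 := by positivity
  have h := (Real.hasDerivAt_arcsin (x := f x) (by rintro h; rw [h] at hfr; linarith)
    (by rintro h; rw [h] at hfr; linarith)).comp x hf
  rw [hfr, Real.sqrt_sq hr.le] at h
  refine h.congr_deriv ?_
  ring

lemma hasDerivAt_arcsin_sq (hm : 0 < m) (hs : 0 < s) (hsm : s ^ 2 = 1 - m ^ 2)
    (hQ : 0 < -1 + 2 * x ^ 2 + -m ^ 2 * x ^ 4) :
    HasDerivAt (fun x : ℝ => arcsin ((m ^ 2 * x ^ 2 - 1) / s))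
      (2 * m * x / √(-1 + 2 * x ^ 2 + -m ^ 2 * x ^ 4)) x := by
  have hR := Real.sqrt_pos.2 hQ
  have h : HasDerivAt (fun x : ℝ => (m ^ 2 * x ^ 2 - 1) / s) (2 * m ^ 2 * x / s) x := by
    refine HasDerivAt.congr_deriv
      ((((hasDerivAt_pow 2 x).const_mul (m ^ 2)).sub_const 1).div_const s) ?_
    norm_num
    ring
  refine HasDerivAt.congr_deriv (hasDerivAt_arcsin_of_sq h
    (r := m * √(-1 + 2 * x ^ 2 + -m ^ 2 * x ^ 4) / s) (by positivity) ?_) ?_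
  · rw [div_pow, div_pow, mul_pow, Real.sq_sqrt hQ.le, radicand_eq hsm]
    field_simp
  · field_simp

lemma hasDerivAt_one_sub_inv_sq_div (hx : 0 < x) :
    HasDerivAt (fun x : ℝ => (1 - (x ^ 2)⁻¹) / s) (2 / (x ^ 3 * s)) x := by
  refine HasDerivAt.congr_deriv
    ((((hasDerivAt_pow 2 x).fun_inv (by positivity)).const_sub 1).div_const s) ?_
  norm_num
  field_simp

lemma hasDerivAt_arcsin_inv_sq (hs : 0 < s) (hsm : s ^ 2 = 1 - m ^ 2) (hx : 0 < x)
    (hQ : 0 < -1 + 2 * x ^ 2 + -m ^ 2 * x ^ 4) :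
    HasDerivAt (fun x : ℝ => arcsin ((1 - (x ^ 2)⁻¹) / s))
      (2 / (x * √(-1 + 2 * x ^ 2 + -m ^ 2 * x ^ 4))) x := by
  have hR := Real.sqrt_pos.2 hQ
  refine HasDerivAt.congr_deriv (hasDerivAt_arcsin_of_sq (hasDerivAt_one_sub_inv_sq_div (s := s) hx)
    (r := √(-1 + 2 * x ^ 2 + -m ^ 2 * x ^ 4) / (x ^ 2 * s)) (by positivity) ?_) ?_
  · rw [div_pow, div_pow, Real.sq_sqrt hQ.le]
    field_simp
    rw [hsm]
    ring
  · field_simp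

lemma integral_zpow_mul_sqrt_radicand {k : ℤ} {F : ℝ → ℝ} (ha : 0 < a) (hab : a ≤ b)
    (hF : ContinuousOn F (Set.Icc a b))
    (hF' : ∀ x ∈ Set.Ioo a b,
      HasDerivAt F (x ^ k * √(-1 + 2 * x ^ 2 + -m ^ 2 * x ^ 4)) x) :
    ∫ x in a..b, x ^ k * √(-1 + 2 * x ^ 2 + -m ^ 2 * x ^ 4) = F b - F a := by
  refine integral_eq_sub_of_hasDerivAt_of_le hab hF hF' (ContinuousOn.intervalIntegrable ?_)
  rw [Set.uIcc_of_le hab]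
  refine ContinuousOn.mul (continuousOn_id.zpow₀ k fun x hx => Or.inl (ha.trans_le hx.1).ne') ?_
  fun_prop

lemma sqrt_radicand_eq_zero (hm : 0 < m) (hsm : s ^ 2 = 1 - m ^ 2)
    (hx : (m ^ 2 * x ^ 2 - 1) ^ 2 = s ^ 2) : √(-1 + 2 * x ^ 2 + -m ^ 2 * x ^ 4) = 0 := by
  have h := radicand_eq (x := x) hsm
  rw [hx, sub_self] at h
  rw [(mul_eq_zero.1 h).resolve_left (by positivity), Real.sqrt_zero]

lemma one_sub_inv_sq_div (hm : 0 < m) (hs : 0 < s) (hsm : s ^ 2 = 1 - m ^ 2) (hx : 0 < x) {e : ℝ}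
    (he : e ^ 2 = 1) (hx2 : m ^ 2 * x ^ 2 = 1 + e * s) : (1 - (x ^ 2)⁻¹) / s = e := by
  field_simp
  apply mul_left_cancel₀ (pow_ne_zero 2 hm.ne')
  linear_combination (1 - e * s) * hx2 - hsm - s ^ 2 * he

end RadicandAntiderivatives

/-- For `h ∈ (−1,0)`, with `α(h) = −1 + √((1+√(1+h))/(−h))`,
`β(h) = −1 + √((1−√(1+h))/(−h))` and
`I_k(h) = ∫_{β(h)}^{α(h)} (1+y)^k √(−1 + 2(1+y)² + h(1+y)⁴) dy`, one has
`I₋₅(h) = (1+h)π/4`, `I₋₃(h) = (1 − √(−h))π/2` and `I₋₁(h) = ((−h)^{−1/2} − 1)π/2`. -/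
theorem stmt5 (h : ℝ) (hh : h ∈ Set.Ioo (-1 : ℝ) 0) :
    (∫ y in (-1 + Real.sqrt ((1 - Real.sqrt (1 + h)) / (-h)))..(-1 +
          Real.sqrt ((1 + Real.sqrt (1 + h)) / (-h))),
        (1 + y) ^ (-5 : ℤ) * Real.sqrt (-1 + 2 * (1 + y) ^ 2 + h * (1 + y) ^ 4))
      = (1 + h) * Real.pi / 4 ∧
    (∫ y in (-1 + Real.sqrt ((1 - Real.sqrt (1 + h)) / (-h)))..(-1 +
          Real.sqrt ((1 + Real.sqrt (1 + h)) / (-h))),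
        (1 + y) ^ (-3 : ℤ) * Real.sqrt (-1 + 2 * (1 + y) ^ 2 + h * (1 + y) ^ 4))
      = (1 - Real.sqrt (-h)) * Real.pi / 2 ∧
    (∫ y in (-1 + Real.sqrt ((1 - Real.sqrt (1 + h)) / (-h)))..(-1 +
          Real.sqrt ((1 + Real.sqrt (1 + h)) / (-h))),
        (1 + y) ^ (-1 : ℤ) * Real.sqrt (-1 + 2 * (1 + y) ^ 2 + h * (1 + y) ^ 4))
      = ((-h) ^ (-(1 : ℝ) / 2) - 1) * Real.pi / 2 := by
  obtain ⟨h1, h0⟩ := hh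
  obtain ⟨m, hm, rfl⟩ : ∃ m : ℝ, 0 < m ∧ h = -m ^ 2 :=
    ⟨√(-h), Real.sqrt_pos.2 (by linarith), by rw [Real.sq_sqrt (by linarith)]; ring⟩
  obtain ⟨s, hs, hsm⟩ : ∃ s : ℝ, 0 < s ∧ s ^ 2 = 1 - m ^ 2 :=
    ⟨√(1 - m ^ 2), Real.sqrt_pos.2 (by linarith), Real.sq_sqrt (by linarith)⟩
  have hm2 : 0 < m ^ 2 := by positivity
  have hs1 : s < 1 := by nlinarith
  have hsqrt : √(1 + -m ^ 2) = s := by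
    rw [← sub_eq_add_neg, ← hsm, Real.sqrt_sq hs.le]
  have hrpow : (m ^ 2) ^ (-(1 : ℝ) / 2) = m⁻¹ := by
    rw [← Real.rpow_natCast m 2, ← Real.rpow_mul hm.le, ← Real.rpow_neg_one]
    norm_num
  rw [hsqrt, neg_neg, Real.sqrt_sq hm.le, hrpow]
  set a := √((1 - s) / m ^ 2) with ha_def
  set b := √((1 + s) / m ^ 2) with hb_def
  have ha : 0 < a := Real.sqrt_pos.2 (div_pos (by linarith) hm2)
  have hb : 0 < b := Real.sqrt_pos.2 (by positivity)
  have hab : a ≤ b := Real.sqrt_le_sqrt (by gcongr; linarith)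
  have ha2 : m ^ 2 * a ^ 2 = 1 - s := by
    rw [ha_def, Real.sq_sqrt (div_nonneg (by linarith) hm2.le)]
    field_simp
  have hb2 : m ^ 2 * b ^ 2 = 1 + s := by
    rw [hb_def, Real.sq_sqrt (by positivity)]
    field_simp
  have hshift (k : ℤ) : ∫ y in (-1 + a)..(-1 + b),
      (1 + y) ^ k * √(-1 + 2 * (1 + y) ^ 2 + -m ^ 2 * (1 + y) ^ 4) =
      ∫ x in a..b, x ^ k * √(-1 + 2 * x ^ 2 + -m ^ 2 * x ^ 4) := by
    rw [intervalIntegral.integral_comp_add_left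
      (fun x : ℝ => x ^ k * √(-1 + 2 * x ^ 2 + -m ^ 2 * x ^ 4)) 1]
    congr 1 <;> ring
  have hpos {x : ℝ} (hx : x ∈ Set.Ioo a b) : 0 < x := ha.trans hx.1
  have hQ {x : ℝ} (hx : x ∈ Set.Ioo a b) := radicand_pos hm hs hsm ha ha2 hb2 hx
  have hne {x : ℝ} (hx : x ∈ Set.Icc a b) : x ^ 2 ≠ 0 := pow_ne_zero 2 (ha.trans_le hx.1).ne'
  have hRa : √(-1 + 2 * a ^ 2 + -m ^ 2 * a ^ 4) = 0 :=
    sqrt_radicand_eq_zero hm hsm (by rw [ha2]; ring)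
  have hRb : √(-1 + 2 * b ^ 2 + -m ^ 2 * b ^ 4) = 0 :=
    sqrt_radicand_eq_zero hm hsm (by rw [hb2]; ring)
  have hAa : (m ^ 2 * a ^ 2 - 1) / s = -1 := by rw [ha2]; field_simp; ring
  have hAb : (m ^ 2 * b ^ 2 - 1) / s = 1 := by rw [hb2]; field_simp; ring
  have hBa : (1 - (a ^ 2)⁻¹) / s = -1 :=
    one_sub_inv_sq_div hm hs hsm ha (by norm_num) (by rw [ha2]; ring)
  have hBb : (1 - (b ^ 2)⁻¹) / s = 1 :=
    one_sub_inv_sq_div hm hs hsm hb (by norm_num) (by rw [hb2]; ring)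
  have hAc : Continuous fun x : ℝ => arcsin ((m ^ 2 * x ^ 2 - 1) / s) :=
    Real.continuous_arcsin.comp (by fun_prop)
  have hIc : ContinuousOn (fun x : ℝ => (x ^ 2)⁻¹) (Set.Icc a b) :=
    (continuous_pow 2).continuousOn.inv₀ fun x hx => hne hx
  have hBc : ContinuousOn (fun x : ℝ => arcsin ((1 - (x ^ 2)⁻¹) / s)) (Set.Icc a b) :=
    Real.continuous_arcsin.comp_continuousOn 
      ((continuousOn_const.sub hIc).div_const s)
  simp only [hshift]
  refine ⟨?_, ?_, ?_⟩
  · rw [integral_zpow_mul_sqrt_radicand (F := fun x =>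
      ((1 - (x ^ 2)⁻¹) / s * (√(-1 + 2 * x ^ 2 + -m ^ 2 * x ^ 4) * (x ^ 2)⁻¹) * s
        + s ^ 2 * arcsin ((1 - (x ^ 2)⁻¹) / s)) / 4) ha hab
      (by fun_prop) fun x hx => ?_]
    · simp only [hRa, hRb, hBa, hBb, arcsin_neg, arcsin_one, hsm]
      ring
    · have hx0 := hpos hx
      have hR := Real.sqrt_pos.2 (hQ hx)
      have hR2 := Real.sq_sqrt (hQ hx).le
      refine HasDerivAt.congr_deriv (((((hasDerivAt_one_sub_inv_sq_div (s := s) hx0).fun_mul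
        ((hasDerivAt_sqrt_radicand (hQ hx)).fun_mul
          ((hasDerivAt_pow 2 x).fun_inv (by positivity)))).mul_const s).add
        ((hasDerivAt_arcsin_inv_sq hs hsm hx0 (hQ hx)).const_mul (s ^ 2))).div_const 4) ?_
      generalize √(-1 + 2 * x ^ 2 + -m ^ 2 * x ^ 4) = R at *
      simp only [zpow_neg]
      norm_cast
      norm_num
      field_simp
      rw [hsm]
      grind
  · rw [integral_zpow_mul_sqrt_radicand (F := fun x =>
      (-(√(-1 + 2 * x ^ 2 + -m ^ 2 * x ^ 4) * (x ^ 2)⁻¹) + arcsin ((1 - (x ^ 2)⁻¹) / s)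
        - m * arcsin ((m ^ 2 * x ^ 2 - 1) / s)) / 2) ha hab
      (by fun_prop) fun x hx => ?_]
    · simp only [hRa, hRb, hAa, hAb, hBa, hBb, arcsin_neg, arcsin_one]
      ring
    · have hx0 := hpos hx
      have hR := Real.sqrt_pos.2 (hQ hx)
      have hR2 := Real.sq_sqrt (hQ hx).le
      refine HasDerivAt.congr_deriv (((((hasDerivAt_sqrt_radicand (hQ hx)).fun_mul
          ((hasDerivAt_pow 2 x).fun_inv (by positivity))).neg.add
        (hasDerivAt_arcsin_inv_sq hs hsm hx0 (hQ hx))).sub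
        ((hasDerivAt_arcsin_sq hm hs hsm (hQ hx)).const_mul m)).div_const 2) ?_
      generalize √(-1 + 2 * x ^ 2 + -m ^ 2 * x ^ 4) = R at *
      simp only [zpow_neg]
      norm_cast
      norm_num
      field_simp
      grind
  · rw [integral_zpow_mul_sqrt_radicand (F := fun x =>
      (√(-1 + 2 * x ^ 2 + -m ^ 2 * x ^ 4) + m⁻¹ * arcsin ((m ^ 2 * x ^ 2 - 1) / s)
        - arcsin ((1 - (x ^ 2)⁻¹) / s)) / 2) ha hab
      (by fun_prop) fun x hx => ?_]
    · simp only [hRa, hRb, hAa, hAb, hBa, hBb, arcsin_neg, arcsin_one]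
      ring
    · have hx0 := hpos hx
      have hR := Real.sqrt_pos.2 (hQ hx)
      have hR2 := Real.sq_sqrt (hQ hx).le
      refine HasDerivAt.congr_deriv ((((hasDerivAt_sqrt_radicand (hQ hx)).add
        ((hasDerivAt_arcsin_sq hm hs hsm (hQ hx)).const_mul m⁻¹)).sub
        (hasDerivAt_arcsin_inv_sq hs hsm hx0 (hQ hx))).div_const 2) ?_
      generalize √(-1 + 2 * x ^ 2 + -m ^ 2 * x ^ 4) = R at *
      simp only [zpow_neg]
      norm_cast
      norm_num
      field_simp
      grind
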